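/- Let (V,J) be a unimodular transitive weighted graph with a distinguished vertex o, and consider Bernoulli bond percolation on it at parameter β ≥ 0. Then the third moment of the cluster volume satisfies E_β|K|³ ≤ C·E_β|K|²·Σ_{x∈V} √(τ_β(o,x)) for a universal constant C (independent of the graph and of β), where K is the cluster of o. -/

import Mathlib

open MeasureTheory ENNReal Filter
open scoped Classical

namespace LRP

/-! ## Generic Bernoulli bond percolation -/

/-- The probability that an edge with rate `t ≥ 0` is open: `1 - e^{-t}`. -/
noncomputable def edgeProb (t : ℝ) : ℝ := 1 - Real.exp (-t)

/-- `μ` is the law of Bernoulli bond percolation in which every unordered pair `e`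
of vertices is open independently with probability `p e`: every finite cylinder
event has the corresponding product probability.  (This characterises `μ` uniquely.) -/
def IsPerc {Vt : Type*} (μ : Measure (Sym2 Vt → Bool)) (p : Sym2 Vt → ℝ) : Prop :=
  IsProbabilityMeasure μ ∧
    ∀ (s : Finset (Sym2 Vt)) (f : Sym2 Vt → Bool),
      μ {ω | ∀ e ∈ s, ω e = f e} =
        ∏ e ∈ s, ENNReal.ofReal (if f e then p e else 1 - p e)

/-- Two vertices are connected if they are joined by a path of open edges. -/
def Conn {Vt : Type*} (ω : Sym2 Vt → Bool) (x y : Vt) : Prop :=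
  Relation.ReflTransGen (fun a b => ω s(a, b) = true) x y

/-- The open cluster of a vertex. -/
def cluster {Vt : Type*} (ω : Sym2 Vt → Bool) (x : Vt) : Set Vt := {y | Conn ω x y}

/-- The number of points of a set, as an extended nonnegative real. -/
noncomputable def eCard {Vt : Type*} (s : Set Vt) : ℝ≥0∞ :=
  if s.Finite then (s.ncard : ℝ≥0∞) else ∞

/-! ## Long-range percolation on `ℤ^d` -/

abbrev V (d : ℕ) := Fin d → ℤ

abbrev Config (d : ℕ) := Sym2 (V d) → Bool

noncomputable def toR {d : ℕ} (x : V d) : Fin d → ℝ := fun i => (x i : ℝ)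

/-- The Euclidean norm of a lattice point. -/
noncomputable def enorm2 {d : ℕ} (x : V d) : ℝ := Real.sqrt (∑ i, ((x i : ℝ)) ^ 2)

/-- The `p`-th moment of the volume of the cluster of the origin. -/
noncomputable def clMom {d : ℕ} (μ : Measure (Config d)) (p : ℕ) : ℝ≥0∞ :=
  ∫⁻ ω, (eCard (cluster ω (0 : V d))) ^ p ∂μ

/-- `E Σ_{x ∈ K} ‖x‖₂^p`. -/
noncomputable def gyr {d : ℕ} (μ : Measure (Config d)) (p : ℝ) : ℝ≥0∞ :=
  ∫⁻ ω, ∑' x : cluster ω (0 : V d), ENNReal.ofReal (enorm2 (x : V d) ^ p) ∂μ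

/-- The `L^p` radius of gyration. -/
noncomputable def xi {d : ℕ} (μ : Measure (Config d)) (p : ℝ) : ℝ≥0∞ :=
  (gyr μ p / clMom μ 1) ^ (1 / p)

/-- A decreasing function `(0, ∞) → (0, 1]` decaying faster than any power. -/
def RapidDecay (h : ℝ → ℝ) : Prop :=
  AntitoneOn h (Set.Ioi (0 : ℝ)) ∧ (∀ t : ℝ, 0 < t → 0 < h t ∧ h t ≤ 1) ∧
    ∀ p : ℝ, 0 < p → Tendsto (fun t => h t * t ^ p) atTop (nhds 0)

/-- The data of a long-range percolation kernel `J(x,y) = 𝟙(x ≠ y) J(‖x - y‖)` on `ℤ^d`,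
together with the standing regularity and normalisation assumptions: `‖⋅‖` is a norm
whose unit ball has unit Lebesgue measure, `J` is decreasing and differentiable with
`|J'(r)| = (1 + δ_r) r^{-d-α-1}`, `δ_r → 0`, and `∫_{r₀}^∞ |δ_r| dr/r < ∞`. -/
structure Kernel (d : ℕ) (α : ℝ) where
  N : Seminorm ℝ (Fin d → ℝ)
  N_pos : ∀ x : Fin d → ℝ, x ≠ 0 → 0 < N x
  N_ball : volume {x : Fin d → ℝ | N x ≤ 1} = 1
  J : ℝ → ℝ
  J' : ℝ → ℝ
  δ : ℝ → ℝ
  J_nonneg : ∀ r : ℝ, 0 < r → 0 ≤ J r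
  J_anti : AntitoneOn J (Set.Ioi (0 : ℝ))
  J_hasDeriv : ∀ r : ℝ, 0 < r → HasDerivAt J (J' r) r
  J'_eq : ∀ r : ℝ, 0 < r → |J' r| = (1 + δ r) * r ^ (-(d : ℝ) - α - 1)
  δ_lim : Tendsto δ atTop (nhds 0)
  δ_int : ∃ r₀ : ℝ, 0 < r₀ ∧ IntegrableOn (fun r => |δ r| / r) (Set.Ioi r₀)

namespace Kernel

variable {d : ℕ} {α : ℝ} (κ : Kernel d α)

/-- The distance between two lattice points in the norm `N`. -/
noncomputable def nd (x y : V d) : ℝ := κ.N (toR x - toR y)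

theorem nd_symm (x y : V d) : κ.nd x y = κ.nd y x := by
  show κ.N (toR x - toR y) = κ.N (toR y - toR x)
  rw [show toR y - toR x = -(toR x - toR y) by abel, map_neg_eq_map]

/-- The kernel `J(x, y)`. -/
noncomputable def ker (x y : V d) : ℝ := if x = y then 0 else κ.J (κ.nd x y)

theorem ker_symm (x y : V d) : κ.ker x y = κ.ker y x := by
  show (if x = y then 0 else κ.J (κ.nd x y)) = (if y = x then 0 else κ.J (κ.nd y x))
  rw [κ.nd_symm x y]
  exact if_congr eq_comm rfl rfl

/-- The cut-off kernel `J_r(x, y)`. -/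
noncomputable def kerCut (r : ℝ) (x y : V d) : ℝ :=
  if x ≠ y ∧ κ.nd x y ≤ r then ∫ s in Set.Ioc (κ.nd x y) r, |κ.J' s| else 0

theorem kerCut_symm (r : ℝ) (x y : V d) : κ.kerCut r x y = κ.kerCut r y x := by
  show (if x ≠ y ∧ κ.nd x y ≤ r then ∫ s in Set.Ioc (κ.nd x y) r, |κ.J' s| else 0) =
    (if y ≠ x ∧ κ.nd y x ≤ r then ∫ s in Set.Ioc (κ.nd y x) r, |κ.J' s| else 0)
  rw [κ.nd_symm x y]
  exact if_congr (and_congr_left' ne_comm) rfl rfl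

/-- Edge probabilities at inverse temperature `β` for the kernel `J`. -/
noncomputable def edgeP (β : ℝ) : Sym2 (V d) → ℝ :=
  Sym2.lift ⟨fun x y => edgeProb (β * κ.ker x y), fun x y => by
    show edgeProb (β * κ.ker x y) = edgeProb (β * κ.ker y x)
    rw [κ.ker_symm x y]⟩

/-- Edge probabilities at inverse temperature `β` for the cut-off kernel `J_r`. -/
noncomputable def edgePCut (β r : ℝ) : Sym2 (V d) → ℝ :=
  Sym2.lift ⟨fun x y => edgeProb (β * κ.kerCut r x y), fun x y => by
    show edgeProb (β * κ.kerCut r x y) = edgeProb (β * κ.kerCut r y x)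
    rw [κ.kerCut_symm r x y]⟩

/-- The ball of radius `r` about the origin of `ℤ^d`, in the norm `N`. -/
def ball (r : ℝ) : Set (V d) := {x : V d | κ.N (toR x) ≤ r}

/-- There is an infinite cluster with positive probability at `β`. -/
def percolates (β : ℝ) : Prop :=
  ∀ μ : Measure (Config d), IsPerc μ (κ.edgeP β) →
    0 < μ {ω | ∃ x : V d, (cluster ω x).Infinite}

/-- The critical point `β_c`. -/
noncomputable def betaC : ℝ := sInf {β : ℝ | 0 ≤ β ∧ κ.percolates β}

/-- The correlation length condition for effectively long-range critical behaviour: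
`β_c < ∞` and for every `p > 0` the `L^p` radius of gyration of the cut-off model
at `β_c` satisfies `ξ_p(β_c, r) ≤ C_p r`. -/
def CL : Prop :=
  (∃ β : ℝ, 0 ≤ β ∧ κ.percolates β) ∧
    ∀ p : ℝ, 0 < p → ∃ C : ℝ, 0 < C ∧
      ∀ r : ℝ, 1 ≤ r → ∀ μ : Measure (Config d), IsPerc μ (κ.edgePCut κ.betaC r) →
        xi μ p ≤ ENNReal.ofReal (C * r)

/-- The weak correlation length condition: `β_c < ∞` and for each `ε > 0` there is
`C` with `E_{β_c,r}|K|^p ≤ (1+ε) E_{β_c,r}|K ∩ B_{Cr}|^p` for all `r ≥ 1`, `p = 1,2,3,4`. -/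
def wCL : Prop :=
  (∃ β : ℝ, 0 ≤ β ∧ κ.percolates β) ∧
    ∀ ε : ℝ, 0 < ε → ∃ C : ℝ, 0 < C ∧
      ∀ r : ℝ, 1 ≤ r → ∀ p : ℕ, p ∈ ({1, 2, 3, 4} : Finset ℕ) →
        ∀ μ : Measure (Config d), IsPerc μ (κ.edgePCut κ.betaC r) →
          (∫⁻ ω, (eCard (cluster ω (0 : V d))) ^ p ∂μ) ≤
            ENNReal.ofReal (1 + ε) *
              ∫⁻ ω, (eCard (cluster ω (0 : V d) ∩ κ.ball (C * r))) ^ p ∂μ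

/-- The `p`-th moment `E_β |K|^p` (for the full kernel). -/
noncomputable def mom (β : ℝ) (p : ℕ) : ℝ≥0∞ :=
  ⨆ μ ∈ {μ : Measure (Config d) | IsPerc μ (κ.edgeP β)}, clMom μ p

/-- The susceptibility `χ(β) = E_β |K|`. -/
noncomputable def chi (β : ℝ) : ℝ≥0∞ := κ.mom β 1

/-- `ζ(β) = E_β|K|² / E_β|K|`. -/
noncomputable def zeta (β : ℝ) : ℝ≥0∞ := κ.mom β 2 / κ.mom β 1

/-- The tail `P_β(|K| ≥ n)` of the cluster volume. -/
noncomputable def tailP (β : ℝ) (n : ℕ) : ℝ≥0∞ :=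
  ⨆ μ ∈ {μ : Measure (Config d) | IsPerc μ (κ.edgeP β)},
    μ {ω | (n : ℝ≥0∞) ≤ eCard (cluster ω (0 : V d))}

/-- The `L^p` radius of gyration `ξ_p(β)` (for the full kernel). -/
noncomputable def xiFull (β : ℝ) (p : ℝ) : ℝ≥0∞ :=
  ⨆ μ ∈ {μ : Measure (Config d) | IsPerc μ (κ.edgeP β)}, xi μ p

/-- The `p`-th moment `E_{β,r} |K|^p` for the cut-off kernel. -/
noncomputable def momCut (β r : ℝ) (p : ℕ) : ℝ≥0∞ :=
  ⨆ μ ∈ {μ : Measure (Config d) | IsPerc μ (κ.edgePCut β r)}, clMom μ p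

/-- `ξ*(β) = χ(β)^{1/α}`. -/
noncomputable def xiStar (β : ℝ) : ℝ := (κ.chi β).toReal ^ α⁻¹

/-- `ζ*(β) = ζ(β_c, ξ*(β))`, where `ζ(β,r) = E_{β,r}|K|²/E_{β,r}|K|`. -/
noncomputable def zetaStar (β : ℝ) : ℝ :=
  (κ.momCut κ.betaC (κ.xiStar β) 2 / κ.momCut κ.betaC (κ.xiStar β) 1).toReal

/-- The edian `M_r` of the maximal cluster volume in `B_r` under `P_{β_c, r}`. -/
noncomputable def MrCut (r : ℝ) : ℕ :=
  sInf {n : ℕ | ∀ μ : Measure (Config d), IsPerc μ (κ.edgePCut κ.betaC r) →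
    μ {ω | ∃ x : V d, (n : ℝ≥0∞) ≤ eCard (cluster ω x ∩ κ.ball r)} ≤
      ENNReal.ofReal (Real.exp (-1))}

/-- The edian `M_r^*` of the maximal cluster volume in `B_r` under `P_{β_c}`. -/
noncomputable def MrFull (r : ℝ) : ℕ :=
  sInf {n : ℕ | ∀ μ : Measure (Config d), IsPerc μ (κ.edgeP κ.betaC) →
    μ {ω | ∃ x : V d, (n : ℝ≥0∞) ≤ eCard (cluster ω x ∩ κ.ball r)} ≤
      ENNReal.ofReal (Real.exp (-1))}

/-- `f(β) = |β - β_c|^{-c ± o(1)}` as `β ↑ β_c`, i.e. the critical exponent of `f`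
at `β_c` is well-defined and equal to `c`. -/
def HasExp (f : ℝ → ℝ≥0∞) (c : ℝ) : Prop :=
  Tendsto (fun β => Real.log (f β).toReal / Real.log (1 / (κ.betaC - β)))
    (nhdsWithin κ.betaC (Set.Iio κ.betaC)) (nhds c)

end Kernel

end LRP

namespace LRP

/-! ## Expectations over finitely many edges -/

section FiniteExpectation

variable {E : Type*} [DecidableEq E] (p : E → ℝ)

/-- The expectation of `F` of the random subset of `D` containing each `e ∈ D` independently with
probability `p e`. -/
noncomputable def finExp (D : Finset E) (F : Finset E → ℝ) : ℝ :=
  ∑ T ∈ D.powerset, ((∏ e ∈ T, p e) * ∏ e ∈ D \ T, (1 - p e)) * F T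

variable {p}

theorem finExp_insert {D : Finset E} {e : E} (he : e ∉ D) (F : Finset E → ℝ) :
    finExp p (insert e D) F =
      (1 - p e) * finExp p D F + p e * finExp p D fun T => F (insert e T) := by
  unfold finExp
  rw [Finset.sum_powerset_insert he, Finset.mul_sum, Finset.mul_sum]
  congr 1
  · refine Finset.sum_congr rfl fun T hT => ?_
    have hT' : e ∉ T := fun h => he (Finset.mem_powerset.1 hT h)
    rw [Finset.insert_sdiff_of_notMem _ hT', Finset.prod_insert (by simp [he])]
    ring
  · refine Finset.sum_congr rfl fun T hT => ?_
    have hT' : e ∉ T := fun h => he (Finset.mem_powerset.1 hT h)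
    rw [Finset.prod_insert hT', Finset.insert_sdiff_insert, Finset.sdiff_insert_of_notMem he]
    ring

theorem finExp_add (D : Finset E) (F G : Finset E → ℝ) :
    finExp p D (fun T => F T + G T) = finExp p D F + finExp p D G := by
  simp only [finExp, mul_add, Finset.sum_add_distrib]

theorem finExp_const_mul (D : Finset E) (c : ℝ) (F : Finset E → ℝ) :
    finExp p D (fun T => c * F T) = c * finExp p D F := by
  simp only [finExp, Finset.mul_sum]
  exact Finset.sum_congr rfl fun T _ => by ring

theorem finExp_one (D : Finset E) : finExp p D (fun _ => 1) = 1 := by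
  induction D using Finset.induction_on with
  | empty => simp [finExp]
  | insert e D he ih => rw [finExp_insert he, ih]; ring

theorem finExp_mono (h0 : ∀ e, 0 ≤ p e) (h1 : ∀ e, p e ≤ 1) {D : Finset E}
    {F G : Finset E → ℝ} (h : ∀ T ⊆ D, F T ≤ G T) : finExp p D F ≤ finExp p D G := by
  refine Finset.sum_le_sum fun T hT => ?_
  refine mul_le_mul_of_nonneg_left (h T (Finset.mem_powerset.1 hT)) ?_
  exact mul_nonneg (Finset.prod_nonneg fun e _ => h0 e)
    (Finset.prod_nonneg fun e _ => sub_nonneg.2 (h1 e))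

theorem finExp_nonneg (h0 : ∀ e, 0 ≤ p e) (h1 : ∀ e, p e ≤ 1) {D : Finset E}
    {F : Finset E → ℝ} (h : ∀ T, 0 ≤ F T) : 0 ≤ finExp p D F := by
  have := finExp_mono h0 h1 (D := D) (F := fun _ => 0 * 1) (G := F) fun T _ => by simpa using h T
  rwa [finExp_const_mul, zero_mul] at this

/-- The real-valued indicator of a proposition. -/
noncomputable def ind (P : Prop) : ℝ := if P then 1 else 0

theorem ind_nonneg (P : Prop) : 0 ≤ ind P := by unfold ind; split_ifs <;> norm_num

theorem ind_mono {P Q : Prop} (h : P → Q) : ind P ≤ ind Q := by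
  unfold ind; split_ifs <;> first | (exfalso; tauto) | norm_num

theorem ind_or_le (P Q : Prop) : ind (P ∨ Q) ≤ ind P + ind Q := by
  unfold ind; split_ifs <;> first | (exfalso; tauto) | norm_num

theorem ind_and (P Q : Prop) : ind (P ∧ Q) = ind P * ind Q := by
  unfold ind; split_ifs <;> first | (exfalso; tauto) | norm_num

variable (p) in
/-- The probability of `A` when the edges of `O` are open and those of `D` are random. -/
noncomputable def prob (O D : Finset E) (A : Finset E → Prop) : ℝ :=
  finExp p D fun T => ind (A (O ∪ T))

variable (p) in
/-- The probability that `A` and `B` occur disjointly when the edges of `O` are open but may only be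
used once, while each edge of `D` is replaced by two independent copies, one of which is
reserved for `A` and the other for `B`. -/
noncomputable def disjProb (O D : Finset E) (A B : Finset E → Prop) : ℝ :=
  finExp p D fun T => finExp p D fun T' =>
    ind (∃ S ⊆ O, A (S ∪ T) ∧ B ((O \ S) ∪ T'))

theorem prob_nonneg (h0 : ∀ e, 0 ≤ p e) (h1 : ∀ e, p e ≤ 1) (O D : Finset E)
    (A : Finset E → Prop) : 0 ≤ prob p O D A :=
  finExp_nonneg h0 h1 fun _ => ind_nonneg _

theorem disjProb_nonneg (h0 : ∀ e, 0 ≤ p e) (h1 : ∀ e, p e ≤ 1) (O D : Finset E)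
    (A B : Finset E → Prop) : 0 ≤ disjProb p O D A B :=
  finExp_nonneg h0 h1 fun _ => finExp_nonneg h0 h1 fun _ => ind_nonneg _

theorem prob_insert {O D : Finset E} {e : E} (he : e ∉ D) (A : Finset E → Prop) :
    prob p O (insert e D) A = (1 - p e) * prob p O D A + p e * prob p (insert e O) D A := by
  unfold prob
  rw [finExp_insert he]
  simp only [Finset.union_insert, Finset.insert_union]

theorem finExp_mul_finExp (D : Finset E) (F G : Finset E → ℝ) :
    finExp p D (fun T => finExp p D fun T' => F T * G T') = finExp p D F * finExp p D G := by
  simp only [finExp_const_mul]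
  rw [mul_comm, ← finExp_const_mul]
  simp only [mul_comm]

theorem disjProb_empty (D : Finset E) (A B : Finset E → Prop) :
    disjProb p ∅ D A B = prob p ∅ D A * prob p ∅ D B := by
  unfold disjProb prob
  rw [← finExp_mul_finExp]
  simp [ind_and, Finset.subset_empty]

/-- Replacing a single edge by two independent copies increases the probability of disjoint
occurrence of two increasing events. -/
theorem disjProb_insert_le (h0 : ∀ e, 0 ≤ p e) (h1 : ∀ e, p e ≤ 1) {O D : Finset E} {e : E}
    (heD : e ∉ D) (heO : e ∉ O) {A B : Finset E → Prop} (hA : Monotone A) (hB : Monotone B) :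
    (1 - p e) * disjProb p O D A B + p e * disjProb p (insert e O) D A B ≤
      disjProb p O (insert e D) A B := by
  unfold disjProb
  simp only [finExp_insert heD]
  simp only [finExp_add, finExp_const_mul]
  simp only [← finExp_const_mul, ← finExp_add]
  refine finExp_mono h0 h1 fun T hT => finExp_mono h0 h1 fun T' hT' => ?_
  have hAe : ∀ S, A (S ∪ T) → A (S ∪ insert e T) := fun S =>
    hA (Finset.union_subset_union_right (Finset.subset_insert _ _))
  have hBe : ∀ S, B (S ∪ T') → B (S ∪ insert e T') := fun S =>
    hB (Finset.union_subset_union_right (Finset.subset_insert _ _))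
  have hq : (∃ S ⊆ insert e O, A (S ∪ T) ∧ B ((insert e O \ S) ∪ T')) →
      (∃ S ⊆ O, A (S ∪ insert e T) ∧ B ((O \ S) ∪ T')) ∨
      ∃ S ⊆ O, A (S ∪ T) ∧ B ((O \ S) ∪ insert e T') := by
    rintro ⟨S, hS, hSA, hSB⟩
    by_cases heS : e ∈ S
    · refine Or.inl ⟨S.erase e, fun x hx => ?_, ?_, ?_⟩
      · obtain ⟨hx1, hx2⟩ := Finset.mem_erase.1 hx
        exact Finset.mem_of_mem_insert_of_ne (hS hx2) hx1
      · convert hSA using 1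
        rw [Finset.union_insert, ← Finset.insert_union, Finset.insert_erase heS]
      · convert hSB using 2
        ext x
        simp only [Finset.mem_sdiff, Finset.mem_erase, Finset.mem_insert]
        constructor
        · rintro ⟨h1, h2⟩
          exact ⟨Or.inr h1, fun h => h2 ⟨fun h' => heO (h' ▸ h1), h⟩⟩
        · rintro ⟨h1 | h1, h2⟩
          · exact absurd heS (h1 ▸ h2)
          · exact ⟨h1, fun h => h2 h.2⟩
    · refine Or.inr ⟨S, fun x hx => ?_, hSA, ?_⟩
      · exact Finset.mem_of_mem_insert_of_ne (hS hx) fun h => heS (h ▸ hx)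
      · convert hSB using 1
        rw [Finset.insert_sdiff_of_notMem _ heS, Finset.union_insert, Finset.insert_union]
  have h00 : (∃ S ⊆ O, A (S ∪ T) ∧ B ((O \ S) ∪ T')) →
      (∃ S ⊆ O, A (S ∪ insert e T) ∧ B ((O \ S) ∪ T')) :=
    fun ⟨S, hS, ha, hb⟩ => ⟨S, hS, hAe _ ha, hb⟩
  have h00' : (∃ S ⊆ O, A (S ∪ T) ∧ B ((O \ S) ∪ T')) →
      (∃ S ⊆ O, A (S ∪ T) ∧ B ((O \ S) ∪ insert e T')) :=
    fun ⟨S, hS, ha, hb⟩ => ⟨S, hS, ha, hBe _ hb⟩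
  have h10 : (∃ S ⊆ O, A (S ∪ insert e T) ∧ B ((O \ S) ∪ T')) →
      (∃ S ⊆ O, A (S ∪ insert e T) ∧ B ((O \ S) ∪ insert e T')) :=
    fun ⟨S, hS, ha, hb⟩ => ⟨S, hS, ha, hBe _ hb⟩
  have h01 : (∃ S ⊆ O, A (S ∪ T) ∧ B ((O \ S) ∪ insert e T')) →
      (∃ S ⊆ O, A (S ∪ insert e T) ∧ B ((O \ S) ∪ insert e T')) :=
    fun ⟨S, hS, ha, hb⟩ => ⟨S, hS, hAe _ ha, hb⟩
  have hp0 := h0 e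
  have hp1 := h1 e
  generalize (∃ S ⊆ insert e O, A (S ∪ T) ∧ B ((insert e O \ S) ∪ T')) = Q at *
  generalize (∃ S ⊆ O, A (S ∪ T) ∧ B ((O \ S) ∪ T')) = P00 at *
  generalize (∃ S ⊆ O, A (S ∪ insert e T) ∧ B ((O \ S) ∪ T')) = P10 at *
  generalize (∃ S ⊆ O, A (S ∪ T) ∧ B ((O \ S) ∪ insert e T')) = P01 at *
  generalize (∃ S ⊆ O, A (S ∪ insert e T) ∧ B ((O \ S) ∪ insert e T')) = P11 at *
  have e00 : ind P00 ≤ ind P10 := ind_mono h00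
  have e00' : ind P00 ≤ ind P01 := ind_mono h00'
  have e11 : ind P00 ≤ ind P11 := ind_mono (h10 ∘ h00)
  have eQ : ind Q ≤ ind P10 + ind P01 := (ind_mono hq).trans (ind_or_le _ _)
  have eQ' : ind Q ≤ ind P11 := ind_mono fun h => (hq h).elim h10 h01
  by_cases hP : P00
  · have hone : ∀ {R : Prop}, R → ind R = 1 := fun h => if_pos h
    have hQ1 : ind Q ≤ 1 := by unfold ind; split_ifs <;> norm_num
    rw [hone hP, hone (h00 hP), hone (h00' hP), hone (h10 (h00 hP))]
    nlinarith
  · have hzero : ind P00 = 0 := if_neg hP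
    rw [hzero]
    have t1 := mul_le_mul_of_nonneg_left eQ (mul_nonneg hp0 (sub_nonneg.2 hp1))
    have t2 := mul_le_mul_of_nonneg_left eQ' (mul_nonneg hp0 hp0)
    linarith

end FiniteExpectation

theorem weighted_sqrt_add_le {q r y₀ y₁ z₀ z₁ y z : ℝ} (hq : 0 ≤ q) (hr : 0 ≤ r)
    (hy₀ : 0 ≤ y₀) (hy₁ : 0 ≤ y₁) (hz₀ : 0 ≤ z₀) (hz₁ : 0 ≤ z₁)
    (hy : q * y₀ + r * y₁ ≤ y) (hz : q * z₀ + r * z₁ ≤ z) :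
    q * √(y₀ * z₀) + r * √(y₁ * z₁) ≤ √(y * z) := by
  refine Real.le_sqrt_of_sq_le (le_trans ?_ (mul_le_mul hy hz (by positivity)
    (le_trans (by positivity) hy)))
  rw [Real.sqrt_mul hy₀, Real.sqrt_mul hy₁]
  obtain ⟨a, ha⟩ : ∃ a, a = √y₀ := ⟨_, rfl⟩
  obtain ⟨b, hb⟩ : ∃ b, b = √y₁ := ⟨_, rfl⟩
  obtain ⟨c, hc⟩ : ∃ c, c = √z₀ := ⟨_, rfl⟩
  obtain ⟨d, hd⟩ : ∃ d, d = √z₁ := ⟨_, rfl⟩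
  have ha2 : a ^ 2 = y₀ := ha ▸ Real.sq_sqrt hy₀
  have hb2 : b ^ 2 = y₁ := hb ▸ Real.sq_sqrt hy₁
  have hc2 : c ^ 2 = z₀ := hc ▸ Real.sq_sqrt hz₀
  have hd2 : d ^ 2 = z₁ := hd ▸ Real.sq_sqrt hz₁
  rw [← ha, ← hb, ← hc, ← hd, ← ha2, ← hb2, ← hc2, ← hd2]
  nlinarith [mul_nonneg (mul_nonneg hq hr) (sq_nonneg (a * d - b * c))]

/-- A list carrying a nonnegative subadditive functional can be split at one of its entries so
that both parts, each including that entry, carry at least half of the total. -/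
theorem exists_half_split {α : Type*} (h : List α → ℝ) (hsub : ∀ L M, h (L ++ M) ≤ h L + h M)
    (h0 : ∀ L, 0 ≤ h L) (l : List α) (hl : l ≠ []) :
    ∃ L v M, l = L ++ v :: M ∧ h l / 2 ≤ h (v :: M) ∧ h l / 2 ≤ h (L ++ [v]) := by
  suffices H : ∀ (M : List α) (L : List α) (v : α), l = L ++ v :: M → h l / 2 ≤ h (v :: M) →
      ∃ L v M, l = L ++ v :: M ∧ h l / 2 ≤ h (v :: M) ∧ h l / 2 ≤ h (L ++ [v]) by
    obtain ⟨v, M, rfl⟩ := List.exists_cons_of_ne_nil hl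
    exact H M [] v rfl (by linarith [h0 (v :: M)])
  intro M
  induction M with
  | nil =>
    intro L v hL hv
    exact ⟨L, v, [], hL, hv, by rw [← hL]; linarith [h0 l]⟩
  | cons w M ih =>
    intro L v hL hv
    by_cases hc : h l / 2 ≤ h (L ++ [v])
    · exact ⟨L, v, w :: M, hL, hv, hc⟩
    · have hl' : l = (L ++ [v]) ++ w :: M := by simp [hL]
      refine ih (L ++ [v]) w hl' ?_
      have := hsub (L ++ [v]) (w :: M)
      rw [← hl'] at this
      linarith

end LRP

namespace LRP

/-! ## Connectivity by finitely many edges and depth-first exploration -/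

section Exploration

variable {W : Type*}

/-- The vertices `x` and `y` are joined by a path with edges in `T`. -/
def Reach (T : Finset (Sym2 W)) (x y : W) : Prop :=
  Relation.ReflTransGen (fun a b => s(a, b) ∈ T) x y

/-- All vertices in `s` are joined to each other by paths with edges in `T`. -/
def AllReach (s : Set W) (T : Finset (Sym2 W)) : Prop := ∀ x ∈ s, ∀ y ∈ s, Reach T x y

theorem Reach.mono {S T : Finset (Sym2 W)} (h : S ⊆ T) {x y : W} (hr : Reach S x y) :
    Reach T x y := Relation.ReflTransGen.mono (fun _ _ hab => h hab) _ _ hr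

theorem Reach.symm {T : Finset (Sym2 W)} {x y : W} (hr : Reach T x y) : Reach T y x := by
  induction hr with
  | refl => exact Relation.ReflTransGen.refl
  | tail _ hab ih => exact Relation.ReflTransGen.head (Sym2.eq_swap ▸ hab) ih

theorem Reach.trans {T : Finset (Sym2 W)} {x y z : W} (h : Reach T x y) (h' : Reach T y z) :
    Reach T x z := Relation.ReflTransGen.trans h h'

theorem Reach.single {T : Finset (Sym2 W)} {x y : W} (h : s(x, y) ∈ T) : Reach T x y :=
  Relation.ReflTransGen.single h

theorem allReach_mono (s : Set W) : Monotone (AllReach s) :=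
  fun _ _ hST h x hx y hy => (h x hx y hy).mono hST

theorem AllReach.of_center {s : Set W} {T : Finset (Sym2 W)} (v : W)
    (h : ∀ x ∈ s, Reach T v x) : AllReach s T :=
  fun x hx y hy => (h x hx).symm.trans (h y hy)

/-- The invariant of a depth-first exploration of the cluster of `a`: the open revealed edges are
`O`, the unrevealed edges are `D`, the discovered vertices are `U`, and the current stack, with its
top first, is `γ`. -/
structure Explored (a : W) (O D : Finset (Sym2 W)) (U : Set W) (γ : List W) : Prop where
  root_mem : a ∈ U
  open_subset : ∀ e ∈ O, ∀ x ∈ e, x ∈ U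
  frontier : ∀ e ∈ D, ∀ x ∈ e, x ∈ U → x ∈ γ
  stack_subset : ∀ x ∈ γ, x ∈ U
  disjoint : Disjoint O D
  last_eq : ∀ h : γ ≠ [], γ.getLast h = a
  split : ∀ L v M, γ = L ++ v :: M → ∃ S ⊆ O, (∀ u ∈ M, Reach S v u) ∧
    (∀ u ∈ L, Reach (O \ S) v u) ∧ ∀ u ∈ U, Reach S v u ∨ Reach (O \ S) v u

namespace Explored

variable {a : W} {O D : Finset (Sym2 W)} {U : Set W} {γ : List W}

theorem start (a : W) (D : Finset (Sym2 W)) : Explored a ∅ D {a} [a] where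
  root_mem := rfl
  open_subset := by simp
  frontier := by simp
  stack_subset := by simp
  disjoint := by simp
  last_eq := by simp
  split := by
    intro L v M h
    have : L = [] ∧ v = a ∧ M = [] := by
      cases L with
      | nil => simpa [eq_comm] using h
      | cons _ _ => simp at h
    obtain ⟨rfl, rfl, rfl⟩ := this
    exact ⟨∅, by simp, by simp, by simp, by
      rintro u rfl; exact Or.inl Relation.ReflTransGen.refl⟩

theorem close (h : Explored a O D U γ) (e : Sym2 W) : Explored a O (D.erase e) U γ :=
  { h with
    frontier := fun e' he' => h.frontier e' (Finset.mem_of_mem_erase he')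
    disjoint := h.disjoint.mono_right (Finset.erase_subset _ _) }

theorem open_internal (h : Explored a O D U γ) {e : Sym2 W} (hU : ∀ x ∈ e, x ∈ U) :
    Explored a (insert e O) (D.erase e) U γ where
  root_mem := h.root_mem
  open_subset := by
    intro e' he'
    rcases Finset.mem_insert.1 he' with rfl | he'
    · exact hU
    · exact h.open_subset e' he'
  frontier := (h.close e).frontier
  stack_subset := h.stack_subset
  disjoint := by
    rw [Finset.disjoint_insert_left]
    exact ⟨by simp, (h.close e).disjoint⟩
  last_eq := h.last_eq
  split := by
    intro L v M hγ
    obtain ⟨S, hS, h1, h2, h3⟩ := h.split L v M hγ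
    have hsub : O \ S ⊆ insert e O \ S :=
      Finset.sdiff_subset_sdiff (Finset.subset_insert _ _) le_rfl
    exact ⟨S, hS.trans (Finset.subset_insert _ _), h1, fun u hu => (h2 u hu).mono hsub,
      fun u hu => (h3 u hu).imp_right fun h => h.mono hsub⟩

theorem top_reach {v : W} (h : Explored a O D U (v :: γ)) {u : W} (hu : u ∈ U) :
    Reach O v u := by
  obtain ⟨S, hS, -, -, h3⟩ := h.split [] v γ rfl
  exact (h3 u hu).elim (fun h => h.mono hS) fun h => h.mono Finset.sdiff_subset

theorem push {v w : W} (h : Explored a O D U (v :: γ)) (hw : w ∉ U) :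
    Explored a (insert s(v, w) O) (D.erase s(v, w)) (insert w U) (w :: v :: γ) where
  root_mem := Or.inr h.root_mem
  open_subset := by
    intro e' he' x hx
    rcases Finset.mem_insert.1 he' with rfl | he'
    · rcases Sym2.mem_iff.1 hx with rfl | rfl
      · exact Or.inr (h.stack_subset _ List.mem_cons_self)
      · exact Or.inl rfl
    · exact Or.inr (h.open_subset e' he' x hx)
  frontier := by
    intro e' he' x hx hxU
    rcases hxU with rfl | hxU
    · exact List.mem_cons_self
    · exact List.mem_cons_of_mem _ ((h.close _).frontier e' he' x hx hxU)
  stack_subset := by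
    intro x hx
    exact (List.mem_cons.1 hx).imp id (h.stack_subset x)
  disjoint := by
    rw [Finset.disjoint_insert_left]
    exact ⟨by simp, (h.close _).disjoint⟩
  last_eq := by
    intro _
    rw [List.getLast_cons (List.cons_ne_nil _ _)]
    exact h.last_eq _
  split := by
    have hedge : s(v, w) ∉ O := fun hO => hw (h.open_subset _ hO w (Sym2.mem_mk_right _ _))
    intro L x M hγ
    cases L with
    | nil =>
      obtain ⟨rfl, rfl⟩ := List.cons.inj hγ
      have hall : ∀ u ∈ insert w U, Reach (insert s(v, w) O) w u := by
        rintro u (rfl | hu)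
        · exact Relation.ReflTransGen.refl
        · exact (Reach.single (Finset.mem_insert_self _ _)).symm.trans
            ((h.top_reach hu).mono (Finset.subset_insert _ _))
      exact ⟨_, le_rfl, fun u hu => hall u (Or.inr (h.stack_subset u hu)), by simp,
        fun u hu => Or.inl (hall u hu)⟩
    | cons y L =>
      obtain ⟨rfl, htail⟩ := List.cons.inj hγ
      obtain ⟨S, hS, h1, h2, h3⟩ := h.split L x M htail
      have hsub : O \ S ⊆ insert s(v, w) O \ S :=
        Finset.sdiff_subset_sdiff (Finset.subset_insert _ _) le_rfl
      have hxv : Reach (O \ S) x v := by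
        cases L with
        | nil =>
          obtain ⟨rfl, -⟩ := List.cons.inj htail
          exact Relation.ReflTransGen.refl
        | cons z L =>
          obtain ⟨rfl, -⟩ := List.cons.inj htail
          exact h2 v List.mem_cons_self
      have hxw : Reach (insert s(v, w) O \ S) x w :=
        (hxv.mono hsub).trans (Reach.single (Finset.mem_sdiff.2
          ⟨Finset.mem_insert_self _ _, fun hs => hedge (hS hs)⟩))
      refine ⟨S, hS.trans (Finset.subset_insert _ _), h1, fun u hu => ?_, ?_⟩
      · rcases List.mem_cons.1 hu with rfl | hu
        exacts [hxw, (h2 u hu).mono hsub]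
      · rintro u (rfl | hu)
        exacts [Or.inr hxw, (h3 u hu).imp_right fun h => h.mono hsub]

theorem pop {v : W} (h : Explored a O D U (v :: γ)) (hv : ∀ e ∈ D, v ∉ e) :
    Explored a O D U γ where
  root_mem := h.root_mem
  open_subset := h.open_subset
  frontier := by
    intro e he x hx hxU
    rcases List.mem_cons.1 (h.frontier e he x hx hxU) with rfl | h'
    · exact absurd hx (hv e he)
    · exact h'
  stack_subset := fun x hx => h.stack_subset x (List.mem_cons_of_mem _ hx)
  disjoint := h.disjoint
  last_eq := by
    intro hγ
    rw [← List.getLast_cons hγ]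
    exact h.last_eq _
  split := by
    intro L x M hγ
    obtain ⟨S, hS, h1, h2, h3⟩ := h.split (v :: L) x M (by simp [hγ])
    exact ⟨S, hS, h1, fun u hu => h2 u (List.mem_cons_of_mem _ hu), h3⟩

/-- A vertex outside the explored region which is joined to it is joined to the stack by
unrevealed edges. -/
theorem exists_reach_stack (h : Explored a O D U γ) {T : Finset (Sym2 W)} (hT : T ⊆ D) {m u : W}
    (hm : m ∉ U) (hu : u ∈ U) (hr : Reach (O ∪ T) m u) : ∃ x ∈ γ, Reach T m x := by
  have key : ∀ y, Reach (O ∪ T) m y → (∃ x ∈ γ, Reach T m x) ∨ (y ∉ U ∧ Reach T m y) := by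
    intro y hy
    induction hy with
    | refl => exact Or.inr ⟨hm, Relation.ReflTransGen.refl⟩
    | @tail y z _ hyz ih =>
      rcases ih with ih | ⟨hyU, hy⟩
      · exact Or.inl ih
      · have hyzT : s(y, z) ∈ T := by
          rcases Finset.mem_union.1 hyz with hO | hT'
          · exact absurd (h.open_subset _ hO y (Sym2.mem_mk_left _ _)) hyU
          · exact hT'
        have hz : Reach T m z := hy.trans (Reach.single hyzT)
        by_cases hzU : z ∈ U
        · exact Or.inl ⟨z, h.frontier _ (hT hyzT) z (Sym2.mem_mk_right _ _) hzU, hz⟩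
        · exact Or.inr ⟨hzU, hz⟩
  rcases key u hr with h' | h'
  · exact h'
  · exact absurd hu h'.1

variable {p : Sym2 W → ℝ}

/-- Once the exploration, started at `a` and with `t` on the top of its stack, has discovered all
of `a`, `t`, `i` but not `m`, a fourth vertex `m` can only be reached through the stack, and two
independent connections to the stack split the explored tree in two. -/
theorem prob_le_sqrt (h0 : ∀ e, 0 ≤ p e) (h1 : ∀ e, p e ≤ 1) {t i m : W}
    (h : Explored a O D U (t :: γ)) (hi : i ∈ U) (hm : m ∉ U) :
    prob p O D (AllReach {a, t, i, m}) ≤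
      2 * √(prob p O D (AllReach {a, t, i}) *
        (disjProb p O D (AllReach {a, i, m}) (AllReach {t, m}) +
          disjProb p O D (AllReach {a, m}) (AllReach {t, i, m}))) := by
  have hY : prob p O D (AllReach {a, t, i}) = 1 := by
    rw [← finExp_one (p := p) D]
    unfold prob
    congr 1
    funext T
    refine if_pos (AllReach.of_center t fun x hx => ?_)
    refine (h.top_reach ?_).mono Finset.subset_union_left
    rcases hx with rfl | rfl | rfl
    exacts [h.root_mem, h.stack_subset _ List.mem_cons_self, hi]
  let f : List W → ℝ := fun l => finExp p D fun T => ind (∃ x ∈ l, Reach T m x)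
  have hf0 : ∀ l, 0 ≤ f l := fun l => finExp_nonneg h0 h1 fun _ => ind_nonneg _
  have hfsub : ∀ l l', f (l ++ l') ≤ f l + f l' := by
    intro l l'
    simp only [f]
    rw [← finExp_add]
    refine finExp_mono h0 h1 fun T _ => (ind_mono ?_).trans (ind_or_le _ _)
    rintro ⟨x, hx, hr⟩
    exact (List.mem_append.1 hx).imp (fun h => ⟨x, h, hr⟩) fun h => ⟨x, h, hr⟩
  obtain ⟨L, v, M, hγ, hM, hL⟩ := exists_half_split f hfsub hf0 (t :: γ) (List.cons_ne_nil _ _)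
  have hX : prob p O D (AllReach {a, t, i, m}) ≤ f (t :: γ) := by
    refine finExp_mono h0 h1 fun T hT => ind_mono fun hr => ?_
    exact h.exists_reach_stack hT hm h.root_mem (hr m (by simp) a (by simp))
  have hQ : f (v :: M) * f (L ++ [v]) ≤
      disjProb p O D (AllReach {a, i, m}) (AllReach {t, m}) +
        disjProb p O D (AllReach {a, m}) (AllReach {t, i, m}) := by
    obtain ⟨S, hS, hSM, hSL, hSU⟩ := h.split L v M hγ
    have hva : Reach S v a := by
      have : a ∈ v :: M := by
        rw [← h.last_eq (List.cons_ne_nil _ _)]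
        simp only [hγ]
        rw [List.getLast_append_of_ne_nil _ (List.cons_ne_nil _ _)]
        exact List.getLast_mem _
      rcases List.mem_cons.1 this with rfl | h'
      · exact Relation.ReflTransGen.refl
      · exact hSM a h'
    have hvt : Reach (O \ S) v t := by
      cases L with
      | nil =>
        obtain ⟨rfl, -⟩ := List.cons.inj hγ
        exact Relation.ReflTransGen.refl
      | cons y L =>
        obtain ⟨rfl, -⟩ := List.cons.inj hγ
        exact hSL t List.mem_cons_self
    simp only [f, disjProb]
    rw [← finExp_mul_finExp]
    simp only [← finExp_add]
    refine finExp_mono h0 h1 fun T _ => finExp_mono h0 h1 fun T' _ => ?_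
    rw [← ind_and]
    refine (ind_mono ?_).trans (ind_or_le _ _)
    rintro ⟨⟨x, hx, hmx⟩, y, hy, hmy⟩
    have hvm : Reach (S ∪ T) v m := by
      have hvx : Reach S v x := by
        rcases List.mem_cons.1 hx with rfl | h'
        exacts [Relation.ReflTransGen.refl, hSM x h']
      exact (hvx.mono Finset.subset_union_left).trans
        (hmx.symm.mono Finset.subset_union_right)
    have hvm' : Reach ((O \ S) ∪ T') v m := by
      have hvy : Reach (O \ S) v y := by
        rcases List.mem_append.1 hy with h' | h'
        · exact hSL y h'
        · rw [List.mem_singleton.1 h']; exact Relation.ReflTransGen.refl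
      exact (hvy.mono Finset.subset_union_left).trans
        (hmy.symm.mono Finset.subset_union_right)
    have hva' := hva.mono (Finset.subset_union_left (s₂ := T))
    have hvt' := hvt.mono (Finset.subset_union_left (s₂ := T'))
    rcases hSU i hi with hvi | hvi
    · have hvi' := hvi.mono (Finset.subset_union_left (s₂ := T))
      refine Or.inl ⟨S, hS, AllReach.of_center v ?_, AllReach.of_center v ?_⟩
      · rintro z (rfl | rfl | rfl) <;> assumption
      · rintro z (rfl | rfl) <;> assumption
    · have hvi' := hvi.mono (Finset.subset_union_left (s₂ := T'))
      refine Or.inr ⟨S, hS, AllReach.of_center v ?_, AllReach.of_center v ?_⟩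
      · rintro z (rfl | rfl) <;> assumption
      · rintro z (rfl | rfl | rfl) <;> assumption
  rw [hY, one_mul]
  have hsq : (f (t :: γ) / 2) ^ 2 ≤ _ :=
    le_trans (by rw [sq]; exact mul_le_mul hM hL (by linarith [hf0 (t :: γ)]) (hf0 _)) hQ
  have := Real.le_sqrt_of_sq_le hsq
  linarith

end Explored

variable (p : Sym2 W → ℝ)

/-- The geometric mean appearing when the exploration discovers `m` last. -/
noncomputable def lastBound (O D : Finset (Sym2 W)) (a x y m : W) : ℝ :=
  √(prob p O D (AllReach {a, x, y}) *
    (disjProb p O D (AllReach {a, y, m}) (AllReach {x, m}) +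
      disjProb p O D (AllReach {a, x, m}) (AllReach {y, m}) +
      disjProb p O D (AllReach {a, m}) (AllReach {x, y, m})))

theorem lastBound_comm (O D : Finset (Sym2 W)) (a x y m : W) :
    lastBound p O D a x y m = lastBound p O D a y x m := by
  unfold lastBound
  rw [Set.pair_comm x y, Set.insert_comm x y {m}, add_comm (disjProb p O D (AllReach {a, y, m}) _)]

variable {p}

theorem lastBound_insert_le (h0 : ∀ e, 0 ≤ p e) (h1 : ∀ e, p e ≤ 1) {O D : Finset (Sym2 W)}
    {e : Sym2 W} (heD : e ∉ D) (heO : e ∉ O) (a x y m : W) :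
    (1 - p e) * lastBound p O D a x y m + p e * lastBound p (insert e O) D a x y m ≤
      lastBound p O (insert e D) a x y m := by
  have hd := fun s t : Set W => disjProb_insert_le h0 h1 heD heO (allReach_mono s) (allReach_mono t)
  have hn := fun (O : Finset (Sym2 W)) (s t : Set W) =>
    disjProb_nonneg h0 h1 O D (AllReach s) (AllReach t)
  refine weighted_sqrt_add_le (sub_nonneg.2 (h1 e)) (h0 e) (prob_nonneg h0 h1 _ _ _)
    (prob_nonneg h0 h1 _ _ _) (add_nonneg (add_nonneg (hn _ _ _) (hn _ _ _)) (hn _ _ _))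
    (add_nonneg (add_nonneg (hn _ _ _) (hn _ _ _)) (hn _ _ _)) (prob_insert heD _).ge ?_
  linarith [hd {a, y, m} {x, m}, hd {a, x, m} {y, m}, hd {a, m} {x, y, m}]

theorem Explored.prob_le_lastBound (h0 : ∀ e, 0 ≤ p e) (h1 : ∀ e, p e ≤ 1)
    {O D : Finset (Sym2 W)} {U : Set W} {γ : List W} {a t i m : W}
    (h : Explored a O D U (t :: γ)) (hi : i ∈ U) (hm : m ∉ U) :
    prob p O D (AllReach {a, t, i, m}) ≤ 2 * lastBound p O D a t i m := by
  refine (h.prob_le_sqrt h0 h1 hi hm).trans ?_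
  unfold lastBound
  have := disjProb_nonneg h0 h1 O D (AllReach {a, t, m}) (AllReach {i, m})
  gcongr
  · exact prob_nonneg h0 h1 _ _ _
  · linarith

/-- A bound on the four-point function, obtained by depth-first exploration. -/
theorem Explored.prob_le (h0 : ∀ e, 0 ≤ p e) (h1 : ∀ e, p e ≤ 1) {a b c d : W}
    (hbc : b ≠ c) (hbd : b ≠ d) (hcd : c ≠ d) {O D : Finset (Sym2 W)} {U : Set W} {γ : List W}
    (h : Explored a O D U γ) (hbcU : ¬(b ∈ U ∧ c ∈ U)) (hbdU : ¬(b ∈ U ∧ d ∈ U))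
    (hcdU : ¬(c ∈ U ∧ d ∈ U)) :
    prob p O D (AllReach {a, b, c, d}) ≤
      2 * (lastBound p O D a b c d + lastBound p O D a b d c + lastBound p O D a c d b) := by
  have hnn : ∀ O D x y m, 0 ≤ lastBound p O D a x y m := fun _ _ _ _ _ => Real.sqrt_nonneg _
  induction hn : 2 * D.card + γ.length using Nat.strong_induction_on generalizing O D U γ with
  | _ n ih =>
  cases γ with
  | nil =>
    have hzero : prob p O D (AllReach {a, b, c, d}) ≤ finExp p D fun _ => 0 * 1 := by
      refine finExp_mono h0 h1 fun T hT => ?_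
      have hno : ∀ m ∈ ({a, b, c, d} : Set W), AllReach {a, b, c, d} (O ∪ T) → m ∈ U := by
        intro m hm hr
        by_contra hmU
        obtain ⟨x, hx, -⟩ := h.exists_reach_stack hT hmU h.root_mem (hr m hm a (by simp))
        simp at hx
      have : ¬AllReach {a, b, c, d} (O ∪ T) := fun hr =>
        hbcU ⟨hno b (by simp) hr, hno c (by simp) hr⟩
      simp [ind, this]
    rw [finExp_const_mul, zero_mul] at hzero
    linarith [hnn O D b c d, hnn O D b d c, hnn O D c d b]
  | cons v γ =>
    by_cases hv : ∃ e ∈ D, v ∈ e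
    · obtain ⟨e, heD, w, rfl⟩ := hv
      have hcard : (D.erase s(v, w)).card + 1 = D.card := Finset.card_erase_add_one heD
      have hstep : prob p (insert s(v, w) O) (D.erase s(v, w)) (AllReach {a, b, c, d}) ≤
          2 * (lastBound p (insert s(v, w) O) (D.erase s(v, w)) a b c d +
            lastBound p (insert s(v, w) O) (D.erase s(v, w)) a b d c +
            lastBound p (insert s(v, w) O) (D.erase s(v, w)) a c d b) →
          prob p O D (AllReach {a, b, c, d}) ≤
            2 * (lastBound p O D a b c d + lastBound p O D a b d c + lastBound p O D a c d b) := by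
        intro hopen
        have hclosed := ih _ (by simp only [← hn]; omega) (h.close s(v, w)) hbcU hbdU hcdU rfl
        have heO : s(v, w) ∉ O := Finset.disjoint_right.1 h.disjoint heD
        have hlast := lastBound_insert_le h0 h1 (Finset.notMem_erase s(v, w) D) heO a
        have hprob := prob_insert (p := p) (O := O) (Finset.notMem_erase s(v, w) D)
          (AllReach {a, b, c, d})
        rw [Finset.insert_erase heD] at hlast hprob
        rw [hprob]
        have t0 := mul_le_mul_of_nonneg_left hclosed (sub_nonneg.2 (h1 s(v, w)))
        have t1 := mul_le_mul_of_nonneg_left hopen (h0 s(v, w))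
        linarith [hlast b c d, hlast b d c, hlast c d b]
      refine hstep ?_
      by_cases hw : w ∈ U
      · have h' := h.open_internal (e := s(v, w)) (by
          intro x hx
          rcases Sym2.mem_iff.1 hx with rfl | rfl
          exacts [h.stack_subset _ List.mem_cons_self, hw])
        exact ih _ (by simp only [← hn]; omega) h' hbcU hbdU hcdU rfl
      · have h' := h.push hw
        by_cases hgood : ¬(b ∈ insert w U ∧ c ∈ insert w U) ∧ ¬(b ∈ insert w U ∧ d ∈ insert w U) ∧
            ¬(c ∈ insert w U ∧ d ∈ insert w U)
        · refine ih _ ?_ h' hgood.1 hgood.2.1 hgood.2.2 rfl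
          simp only [← hn, List.length_cons]
          omega
        · have hlast := fun {i m : W} => h'.prob_le_lastBound h0 h1 (i := i) (m := m)
          have hcomm := lastBound_comm p (insert s(v, w) O) (D.erase s(v, w)) a
          have hn' := hnn (insert s(v, w) O) (D.erase s(v, w))
          have e1 : ({a, c, b, d} : Set W) = {a, b, c, d} := by rw [Set.insert_comm c b]
          have e2 : ({a, b, d, c} : Set W) = {a, b, c, d} := by rw [Set.pair_comm d c]
          have e3 : ({a, d, b, c} : Set W) = {a, b, c, d} := by rw [Set.insert_comm d b, e2]
          have e4 : ({a, c, d, b} : Set W) = {a, b, c, d} := by rw [Set.pair_comm d b, e1]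
          have e5 : ({a, d, c, b} : Set W) = {a, b, c, d} := by rw [Set.insert_comm d c, e4]
          have hcases : (w = b ∧ c ∈ U ∧ d ∉ U) ∨ (w = b ∧ d ∈ U ∧ c ∉ U) ∨
              (w = c ∧ b ∈ U ∧ d ∉ U) ∨ (w = c ∧ d ∈ U ∧ b ∉ U) ∨
              (w = d ∧ b ∈ U ∧ c ∉ U) ∨ (w = d ∧ c ∈ U ∧ b ∉ U) := by
            simp only [Set.mem_insert_iff] at hgood
            grind
          rcases hcases with ⟨rfl, hi, hm⟩ | ⟨rfl, hi, hm⟩ | ⟨rfl, hi, hm⟩ | ⟨rfl, hi, hm⟩ |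
            ⟨rfl, hi, hm⟩ | ⟨rfl, hi, hm⟩
          · have := hlast (Or.inr hi) (m := d) (by simp [hm, hbd.symm])
            linarith [hn' w c d, hn' w d c, hn' c d w]
          · have := hlast (Or.inr hi) (m := c) (by simp [hm, hbc.symm])
            rw [e2] at this
            linarith [hn' w c d, hn' w d c, hn' c d w]
          · have := hlast (Or.inr hi) (m := d) (by simp [hm, hcd.symm])
            rw [e1, hcomm] at this
            linarith [hn' b w d, hn' b d w, hn' w d b]
          · have := hlast (Or.inr hi) (m := b) (by simp [hm, hbc])
            rw [e4] at this
            linarith [hn' b w d, hn' b d w, hn' w d b]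
          · have := hlast (Or.inr hi) (m := c) (by simp [hm, hcd])
            rw [e3, hcomm] at this
            linarith [hn' b c w, hn' b w c, hn' c w b]
          · have := hlast (Or.inr hi) (m := b) (by simp [hm, hbd])
            rw [e5, hcomm] at this
            linarith [hn' b c w, hn' b w c, hn' c w b]
    · push Not at hv
      refine ih _ ?_ (h.pop hv) hbcU hbdU hcdU rfl
      simp only [← hn, List.length_cons]
      omega

variable (p) in
/-- The probability that the vertices of `s` are connected by open edges of `D`. -/
noncomputable def connProb (D : Finset (Sym2 W)) (s : Set W) : ℝ := prob p ∅ D (AllReach s)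

theorem connProb_nonneg (h0 : ∀ e, 0 ≤ p e) (h1 : ∀ e, p e ≤ 1) (D : Finset (Sym2 W))
    (s : Set W) : 0 ≤ connProb p D s := prob_nonneg h0 h1 _ _ _

/-- A bound on the four-point function by two- and three-point functions. -/
theorem connProb_four_le (h0 : ∀ e, 0 ≤ p e) (h1 : ∀ e, p e ≤ 1) (D : Finset (Sym2 W))
    {a b c d : W} (hbc : b ≠ c) (hbd : b ≠ d) (hcd : c ≠ d) :
    connProb p D {a, b, c, d} ≤
      2 * (√(connProb p D {a, b, c} * (connProb p D {a, c, d} * connProb p D {b, d} +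
          connProb p D {a, b, d} * connProb p D {c, d} +
          connProb p D {a, d} * connProb p D {b, c, d})) +
        √(connProb p D {a, b, d} * (connProb p D {a, d, c} * connProb p D {b, c} +
          connProb p D {a, b, c} * connProb p D {d, c} +
          connProb p D {a, c} * connProb p D {b, d, c})) +
        √(connProb p D {a, c, d} * (connProb p D {a, d, b} * connProb p D {c, b} +
          connProb p D {a, c, b} * connProb p D {d, b} +
          connProb p D {a, b} * connProb p D {c, d, b}))) := by
  have hU : ∀ {x y : W}, x ≠ y → ¬(x ∈ ({a} : Set W) ∧ y ∈ ({a} : Set W)) :=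
    fun hxy h => hxy (h.1.trans h.2.symm)
  have := (Explored.start a D).prob_le h0 h1 hbc hbd hcd (hU hbc) (hU hbd) (hU hcd)
  simpa only [connProb, lastBound, disjProb_empty] using this

end Exploration

end LRP

namespace LRP

/-! ## Passage to infinitely many edges -/

section Infinite

variable {W : Type*}

/-- The edges of `E` that are open in `ω`. -/
noncomputable def openIn (E : Finset (Sym2 W)) (ω : Sym2 W → Bool) : Finset (Sym2 W) :=
  E.filter fun e => ω e = true

/-- The event that all vertices of `s` lie in the same open cluster. -/
def allConn (s : Set W) : Set (Sym2 W → Bool) := {ω | ∀ x ∈ s, ∀ y ∈ s, Conn ω x y}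

theorem openIn_eq_iff {E T : Finset (Sym2 W)} (hT : T ⊆ E) {ω : Sym2 W → Bool} :
    openIn E ω = T ↔ ∀ e ∈ E, ω e = decide (e ∈ T) := by
  constructor
  · rintro rfl e he
    by_cases h : ω e = true <;> simp [openIn, he, h]
  · intro h
    ext e
    simp only [openIn, Finset.mem_filter]
    constructor
    · rintro ⟨he, h'⟩
      simpa [h e he] using h'
    · intro he
      exact ⟨hT he, by simp [h e (hT he), he]⟩

theorem openIn_event_eq (E : Finset (Sym2 W)) (A : Finset (Sym2 W) → Prop) :
    {ω | A (openIn E ω)} =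
      ⋃ T ∈ E.powerset.filter A, {ω : Sym2 W → Bool | ∀ e ∈ E, ω e = decide (e ∈ T)} := by
  ext ω
  simp only [Set.mem_ofPred_eq, Set.mem_iUnion, Finset.mem_filter, Finset.mem_powerset, exists_prop]
  constructor
  · intro h
    have hs : openIn E ω ⊆ E := Finset.filter_subset _ _
    exact ⟨_, ⟨hs, h⟩, (openIn_eq_iff hs).1 rfl⟩
  · rintro ⟨T, ⟨hT, hA⟩, h⟩
    rwa [(openIn_eq_iff hT).2 h]

theorem measurableSet_cylinder (E : Finset (Sym2 W)) (f : Sym2 W → Bool) :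
    MeasurableSet {ω : Sym2 W → Bool | ∀ e ∈ E, ω e = f e} := by
  have : {ω : Sym2 W → Bool | ∀ e ∈ E, ω e = f e} = ⋂ e ∈ E, (fun ω => ω e) ⁻¹' {f e} := by
    ext; simp
  rw [this]
  exact Finset.measurableSet_biInter _ fun e _ => measurable_pi_apply e (measurableSet_singleton _)

theorem measurableSet_openIn_event (E : Finset (Sym2 W)) (A : Finset (Sym2 W) → Prop) :
    MeasurableSet {ω | A (openIn E ω)} := by
  rw [openIn_event_eq]
  exact Finset.measurableSet_biUnion _ fun T _ => measurableSet_cylinder E _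

theorem conn_iff_exists_reach {ω : Sym2 W → Bool} {x y : W} :
    Conn ω x y ↔ ∃ E, Reach (openIn E ω) x y := by
  constructor
  · intro h
    induction h with
    | refl => exact ⟨∅, Relation.ReflTransGen.refl⟩
    | @tail y z _ hyz ih =>
      obtain ⟨E, hE⟩ := ih
      refine ⟨insert s(y, z) E, (hE.mono ?_).trans (Reach.single ?_)⟩
      · exact Finset.filter_subset_filter _ (Finset.subset_insert _ _)
      · simp [openIn, hyz]
  · rintro ⟨E, hE⟩
    induction hE with
    | refl => exact Relation.ReflTransGen.refl
    | tail _ h ih => exact ih.tail (Finset.mem_filter.1 h).2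

theorem openIn_mono (ω : Sym2 W → Bool) : Monotone fun E => openIn E ω :=
  fun _ _ h => Finset.filter_subset_filter _ h

theorem allConn_eq_iUnion {s : Set W} (hs : s.Finite) :
    allConn s = ⋃ E, {ω | AllReach s (openIn E ω)} := by
  ext ω
  simp only [allConn, Set.mem_ofPred_eq, Set.mem_iUnion]
  constructor
  · intro h
    have h' : ∀ x y, ∃ E, x ∈ s → y ∈ s → Reach (openIn E ω) x y := by
      intro x y
      by_cases hxy : x ∈ s ∧ y ∈ s
      · obtain ⟨E, hE⟩ := conn_iff_exists_reach.1 (h x hxy.1 y hxy.2)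
        exact ⟨E, fun _ _ => hE⟩
      · exact ⟨∅, fun hx hy => absurd ⟨hx, hy⟩ hxy⟩
    choose E hE using h'
    refine ⟨hs.toFinset.biUnion fun x => hs.toFinset.biUnion (E x), fun x hx y hy => ?_⟩
    refine (hE x y hx hy).mono (openIn_mono ω ?_)
    exact (Finset.subset_biUnion_of_mem (E x) (hs.mem_toFinset.2 hy)).trans
      (Finset.subset_biUnion_of_mem (fun x => hs.toFinset.biUnion (E x)) (hs.mem_toFinset.2 hx))
  · rintro ⟨E, hE⟩ x hx y hy
    exact conn_iff_exists_reach.2 ⟨E, hE x hx y hy⟩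

theorem measurableSet_allConn [Countable W] {s : Set W} (hs : s.Finite) :
    MeasurableSet (allConn s) := by
  rw [allConn_eq_iUnion hs]
  have : Countable (Sym2 W) := inferInstanceAs (Countable (Quot _))
  exact MeasurableSet.iUnion fun E => measurableSet_openIn_event E _

theorem Conn.symm {ω : Sym2 W → Bool} {x y : W} (h : Conn ω x y) : Conn ω y x := by
  obtain ⟨E, hE⟩ := conn_iff_exists_reach.1 h
  exact conn_iff_exists_reach.2 ⟨E, hE.symm⟩

theorem mem_allConn_insert {ω : Sym2 W → Bool} {x : W} {s : Set W} :
    ω ∈ allConn (insert x s) ↔ ∀ y ∈ s, Conn ω x y := by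
  constructor
  · exact fun h y hy => h x (Or.inl rfl) y (Or.inr hy)
  · intro h
    have h' : ∀ y ∈ insert x s, Conn ω x y := by
      rintro y (rfl | hy)
      exacts [Relation.ReflTransGen.refl, h y hy]
    exact fun y hy z hz => (h' y hy).symm.trans (h' z hz)

variable {p : Sym2 W → ℝ} {μ : Measure (Sym2 W → Bool)}

theorem IsPerc.measure_openIn_event (hμ : IsPerc μ p) (h0 : ∀ e, 0 ≤ p e) (h1 : ∀ e, p e ≤ 1)
    (E : Finset (Sym2 W)) (A : Finset (Sym2 W) → Prop) :
    μ {ω | A (openIn E ω)} = ENNReal.ofReal (prob p ∅ E A) := by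
  have hw : ∀ T ∈ E.powerset, μ {ω | ∀ e ∈ E, ω e = decide (e ∈ T)} =
      ENNReal.ofReal ((∏ e ∈ T, p e) * ∏ e ∈ E \ T, (1 - p e)) := by
    intro T hT
    rw [hμ.2, ← ENNReal.ofReal_prod_of_nonneg]
    · congr 1
      rw [← Finset.prod_sdiff (Finset.mem_powerset.1 hT), mul_comm]
      congr 1
      · exact Finset.prod_congr rfl fun e he => by simp [he]
      · exact Finset.prod_congr rfl fun e he => by simp [(Finset.mem_sdiff.1 he).2]
    · intro e _
      split_ifs
      exacts [h0 e, sub_nonneg.2 (h1 e)]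
  rw [openIn_event_eq, measure_biUnion_finset]
  · unfold prob finExp
    rw [ENNReal.ofReal_sum_of_nonneg, Finset.sum_filter]
    · refine Finset.sum_congr rfl fun T hT => ?_
      simp only [Finset.empty_union]
      by_cases hA : A T <;> simp only [hA, ind, if_true, if_false, mul_one, mul_zero,
        ENNReal.ofReal_zero]
      exact hw T hT
    · intro T _
      exact mul_nonneg (mul_nonneg (Finset.prod_nonneg fun e _ => h0 e)
        (Finset.prod_nonneg fun e _ => sub_nonneg.2 (h1 e))) (ind_nonneg _)
  · intro T hT T' hT' hne
    refine Set.disjoint_left.2 fun ω hω hω' => hne ?_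
    have hs : ∀ {T}, T ∈ (E.powerset.filter A : Finset _) → T ⊆ E := fun h =>
      Finset.mem_powerset.1 (Finset.mem_filter.1 h).1
    rw [← (openIn_eq_iff (hs hT)).2 hω, ← (openIn_eq_iff (hs hT')).2 hω']
  · exact fun T _ => measurableSet_cylinder E _

theorem IsPerc.measure_allConn [Countable W] (hμ : IsPerc μ p) (h0 : ∀ e, 0 ≤ p e)
    (h1 : ∀ e, p e ≤ 1) {s : Set W} (hs : s.Finite) :
    μ (allConn s) = ⨆ E, ENNReal.ofReal (connProb p E s) := by
  have : Countable (Sym2 W) := inferInstanceAs (Countable (Quot _))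
  rw [allConn_eq_iUnion hs, Directed.measure_iUnion]
  · exact iSup_congr fun E => hμ.measure_openIn_event h0 h1 E _
  · refine directed_of_isDirected_le fun E E' hE ω hω => ?_
    exact allReach_mono s (openIn_mono ω hE) hω

theorem conn_comp_equiv {g : W ≃ W} {ω : Sym2 W → Bool} {x y : W} :
    Conn (fun e => ω (e.map g)) x y ↔ Conn ω (g x) (g y) := by
  constructor
  · intro h
    induction h with
    | refl => exact Relation.ReflTransGen.refl
    | tail _ h ih => exact ih.tail (by simpa using h)
  · intro h
    have key : ∀ z, Conn ω (g x) z → Conn (fun e => ω (e.map g)) x (g.symm z) := by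
      intro z hz
      induction hz with
      | refl =>
        rw [g.symm_apply_apply]
        exact Relation.ReflTransGen.refl
      | tail _ h ih => exact ih.tail (by simpa using h)
    simpa using key _ h

/-- Connection probabilities are invariant under automorphisms. -/
theorem IsPerc.measure_allConn_image [Countable W] (hμ : IsPerc μ p) (h0 : ∀ e, 0 ≤ p e)
    (h1 : ∀ e, p e ≤ 1) (g : W ≃ W) (hg : ∀ e, p (e.map g) = p e) {s : Set W} (hs : s.Finite) :
    μ (allConn (g '' s)) = μ (allConn s) := by
  have hmeas : Measurable fun (ω : Sym2 W → Bool) (e : Sym2 W) => ω (e.map g) :=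
    measurable_pi_lambda _ fun e => measurable_pi_apply _
  have hν : IsPerc (μ.map fun ω e => ω (e.map g)) p := by
    have := hμ.1
    refine ⟨Measure.isProbabilityMeasure_map hmeas.aemeasurable, fun E f => ?_⟩
    rw [Measure.map_apply hmeas (measurableSet_cylinder E f)]
    have hinj : Function.Injective (Sym2.map g) := Sym2.map.injective g.injective
    have := hμ.2 (E.image (Sym2.map g)) fun e => f (e.map g.symm)
    have hinv : ∀ e : Sym2 W, (e.map g).map g.symm = e := by
      intro e
      rw [Sym2.map_map]
      simp
    rw [Finset.prod_image hinj.injOn] at this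
    simp only [hinv, hg] at this
    rw [← this]
    congr 1
    ext ω
    simp [hinv]
  rw [hμ.measure_allConn h0 h1 hs, ← hν.measure_allConn h0 h1 hs,
    Measure.map_apply hmeas (measurableSet_allConn hs)]
  congr 1
  ext ω
  simp only [allConn, Set.forall_mem_image, Set.mem_preimage, Set.mem_ofPred_eq, conn_comp_equiv]

theorem sqrt_mul_sum_le {y a b c u v w : ℝ} (hy : 0 ≤ y) (ha : 0 ≤ a) (hb : 0 ≤ b) (hc : 0 ≤ c)
    (hu : 0 ≤ u) (hv : 0 ≤ v) (hw : 0 ≤ w) :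
    √(y * (a * u + b * v + c * w)) ≤ (y + a) * √u + (y + b) * √v + (y + c) * √w := by
  have key : ∀ {a u : ℝ}, 0 ≤ a → 0 ≤ u → √(y * (a * u)) ≤ (y + a) * √u := by
    intro a u ha hu
    rw [← mul_assoc, Real.sqrt_mul (mul_nonneg hy ha)]
    refine mul_le_mul_of_nonneg_right (Real.sqrt_le_iff.2 ⟨by positivity, ?_⟩) (Real.sqrt_nonneg _)
    nlinarith [mul_nonneg hy ha]
  have hadd : ∀ {x z : ℝ}, 0 ≤ x → 0 ≤ z → √(x + z) ≤ √x + √z := by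
    intro x z hx hz
    refine Real.sqrt_le_iff.2 ⟨by positivity, ?_⟩
    nlinarith [Real.sq_sqrt hx, Real.sq_sqrt hz, mul_nonneg (Real.sqrt_nonneg x) (Real.sqrt_nonneg z)]
  rw [mul_add, mul_add]
  have e1 := hadd (x := y * (a * u) + y * (b * v)) (z := y * (c * w)) (by positivity) (by positivity)
  have e2 := hadd (x := y * (a * u)) (z := y * (b * v)) (by positivity) (by positivity)
  linarith [key ha hu, key hb hv, key hc hw]

/-- The four-point function is bounded by three-point functions and square roots of two-point
functions. -/
theorem IsPerc.measure_allConn_four_le [Countable W] (hμ : IsPerc μ p) (h0 : ∀ e, 0 ≤ p e)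
    (h1 : ∀ e, p e ≤ 1) (a b c d : W) :
    μ (allConn {a, b, c, d}) ≤
      4 * ((μ (allConn {a, b, c}) + μ (allConn {a, c, d})) * μ (allConn {b, d}) ^ ((1 : ℝ) / 2) +
        (μ (allConn {a, b, c}) + μ (allConn {a, b, d})) * μ (allConn {c, d}) ^ ((1 : ℝ) / 2) +
        (μ (allConn {a, b, d}) + μ (allConn {a, c, d})) * μ (allConn {b, c}) ^ ((1 : ℝ) / 2) +
        (μ (allConn {a, b, c}) + μ (allConn {b, c, d})) * μ (allConn {a, d}) ^ ((1 : ℝ) / 2) +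
        (μ (allConn {a, b, d}) + μ (allConn {b, c, d})) * μ (allConn {a, c}) ^ ((1 : ℝ) / 2) +
        (μ (allConn {a, c, d}) + μ (allConn {b, c, d})) * μ (allConn {a, b}) ^ ((1 : ℝ) / 2)) := by
  have := hμ.1
  have hself : ∀ x : W, μ (allConn {x, x}) = 1 := by
    intro x
    have : allConn {x, x} = Set.univ := by
      ext ω
      simp [allConn, Conn, Relation.ReflTransGen.refl]
    rw [this, measure_univ]
  have honefour : ∀ x : ℝ≥0∞, x ≤ 4 * (x * 1) := fun x => by
    rw [mul_one]
    exact le_mul_of_one_le_left' (by norm_num)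
  have hlow : ∀ {x y z : ℝ≥0∞}, x ≤ y → y * 1 ≤ z → x ≤ 4 * z := fun hx hz =>
    (hx.trans (honefour _)).trans (mul_le_mul_right hz _)
  have hmono : ∀ {s t : Set W}, s = t → μ (allConn s) ≤ μ (allConn t) := fun h => by rw [h]
  by_cases hbc : b = c
  · subst hbc
    rw [hself, ENNReal.one_rpow]
    refine hlow (hmono (t := {a, b, d}) (by ext; simp)) ?_
    refine le_add_right (le_add_right (le_add_right (le_add_left ?_)))
    gcongr
    exact le_self_add
  by_cases hbd : b = d
  · subst hbd
    rw [hself, ENNReal.one_rpow]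
    refine hlow (hmono (t := {a, b, c}) (by ext; simp; tauto)) ?_
    refine le_add_right (le_add_right (le_add_right (le_add_right (le_add_right ?_))))
    gcongr
    exact le_self_add
  by_cases hcd : c = d
  · subst hcd
    rw [hself, ENNReal.one_rpow]
    refine hlow (hmono (t := {a, b, c}) (by ext; simp)) ?_
    refine le_add_right (le_add_right (le_add_right (le_add_right (le_add_left ?_))))
    gcongr
    exact le_self_add
  rw [hμ.measure_allConn h0 h1 (s := {a, b, c, d}) (by simp)]
  refine iSup_le fun E => ?_
  have hbound : ∀ s : Set W, s.Finite → connProb p E s ≤ (μ (allConn s)).toNNReal := by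
    intro s hs
    have h : ENNReal.ofReal (connProb p E s) ≤ μ (allConn s) := by
      rw [hμ.measure_allConn h0 h1 hs]
      exact le_iSup (fun E => ENNReal.ofReal (connProb p E s)) E
    exact (ENNReal.ofReal_le_iff_le_toReal (measure_ne_top _ _)).1 h
  have hcoe : ∀ s : Set W, μ (allConn s) = ((μ (allConn s)).toNNReal : ℝ≥0∞) := fun s =>
    (ENNReal.coe_toNNReal (measure_ne_top _ _)).symm
  have hnn : ∀ s, 0 ≤ connProb p E s := fun s => connProb_nonneg h0 h1 E s
  have habc := hbound {a, b, c} (by simp)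
  have habd := hbound {a, b, d} (by simp)
  have hacd := hbound {a, c, d} (by simp)
  have hbcd := hbound {b, c, d} (by simp)
  have hab := hbound {a, b} (by simp)
  have hac := hbound {a, c} (by simp)
  have had := hbound {a, d} (by simp)
  have hbc' := hbound {b, c} (by simp)
  have hbd' := hbound {b, d} (by simp)
  have hcd' := hbound {c, d} (by simp)
  have hfour := connProb_four_le h0 h1 E (a := a) hbc hbd hcd
  rw [Set.pair_comm d c, Set.pair_comm c b, Set.pair_comm d b, Set.insert_comm c b {d}] at hfour
  rw [hcoe {a, b, c}, hcoe {a, b, d}, hcoe {a, c, d}, hcoe {b, c, d}, hcoe {a, b}, hcoe {a, c},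
    hcoe {a, d}, hcoe {b, c}, hcoe {b, d}, hcoe {c, d}]
  generalize (μ (allConn {a, b, c})).toNNReal = xabc at *
  generalize (μ (allConn {a, b, d})).toNNReal = xabd at *
  generalize (μ (allConn {a, c, d})).toNNReal = xacd at *
  generalize (μ (allConn {b, c, d})).toNNReal = xbcd at *
  generalize (μ (allConn {a, b})).toNNReal = xab at *
  generalize (μ (allConn {a, c})).toNNReal = xac at *
  generalize (μ (allConn {a, d})).toNNReal = xad at *
  generalize (μ (allConn {b, c})).toNNReal = xbc at *
  generalize (μ (allConn {b, d})).toNNReal = xbd at *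
  generalize (μ (allConn {c, d})).toNNReal = xcd at *
  simp only [← ENNReal.coe_rpow_of_nonneg _ (show (0 : ℝ) ≤ 1 / 2 by norm_num)]
  norm_cast
  refine hfour.trans ?_
  push_cast
  simp only [← Real.sqrt_eq_rpow]
  have hsum := fun (x y z w : NNReal) (u v t : NNReal) =>
    sqrt_mul_sum_le x.coe_nonneg y.coe_nonneg z.coe_nonneg w.coe_nonneg u.coe_nonneg v.coe_nonneg
      t.coe_nonneg
  have hstep : ∀ {x y z w u v t : ℝ} {x' y' z' w' u' v' t' : NNReal}, 0 ≤ x → 0 ≤ y → 0 ≤ z →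
      0 ≤ w → 0 ≤ u → 0 ≤ v → 0 ≤ t → x ≤ x' → y ≤ y' → z ≤ z' → w ≤ w' → u ≤ u' → v ≤ v' →
      t ≤ t' → √(x * (y * u + z * v + w * t)) ≤
        (x' + y') * √u' + (x' + z') * √v' + (x' + w') * √t' := by
    intro x y z w u v t x' y' z' w' u' v' t' _ _ _ _ _ _ _ _ _ _ _ _ _ _
    refine le_trans (Real.sqrt_le_sqrt ?_) (hsum x' y' z' w' u' v' t')
    gcongr
  have e1 := hstep (hnn _) (hnn _) (hnn _) (hnn _) (hnn _) (hnn _) (hnn _)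
    habc hacd habd hbcd hbd' hcd' had
  have e2 := hstep (hnn _) (hnn _) (hnn _) (hnn _) (hnn _) (hnn _) (hnn _)
    habd hacd habc hbcd hbc' hcd' hac
  have e3 := hstep (hnn _) (hnn _) (hnn _) (hnn _) (hnn _) (hnn _) (hnn _)
    hacd habd habc hbcd hbc' hbd' hab
  rw [mul_comm (connProb p E {b, c, d})] at e1 e2 e3
  have hpos : (0 : ℝ) ≤ (xabc + xbcd) * √xad + (xabd + xbcd) * √xac + (xacd + xbcd) * √xab := by
    positivity
  linarith

end Infinite

end LRP

namespace LRP

/-! ## Moments of the cluster volume -/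

section Moments

variable {W : Type*} {p : Sym2 W → ℝ} {μ : Measure (Sym2 W → Bool)}

theorem eCard_eq_tsum (s : Set W) : eCard s = ∑' x, s.indicator (fun _ => (1 : ℝ≥0∞)) x := by
  rw [← tsum_subtype, ENNReal.tsum_set_one]
  unfold eCard
  split_ifs with h
  · rw [← h.cast_ncard_eq]
    simp
  · rw [Set.Infinite.encard_eq h]
    simp

theorem indicator_mul_allConn (ω : Sym2 W → Bool) (x y : W) (s : Set W) :
    (cluster ω x).indicator (fun _ => (1 : ℝ≥0∞)) y *
        (allConn (insert x s)).indicator (fun _ => 1) ω =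
      (allConn (insert x (insert y s))).indicator (fun _ => 1) ω := by
  have h : ω ∈ allConn (insert x (insert y s)) ↔
      y ∈ cluster ω x ∧ ω ∈ allConn (insert x s) := by
    simp [mem_allConn_insert, cluster]
  by_cases h1 : y ∈ cluster ω x <;> by_cases h2 : ω ∈ allConn (insert x s) <;>
    simp [Set.indicator, h, h1, h2]

theorem indicator_cluster (ω : Sym2 W → Bool) (x y : W) :
    (cluster ω x).indicator (fun _ => (1 : ℝ≥0∞)) y = (allConn {x, y}).indicator (fun _ => 1) ω := by
  have h : ω ∈ allConn {x, y} ↔ y ∈ cluster ω x := by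
    simp [mem_allConn_insert, cluster]
  by_cases h1 : y ∈ cluster ω x <;> simp [Set.indicator, h, h1]

theorem eCard_cluster_sq (ω : Sym2 W → Bool) (x : W) :
    eCard (cluster ω x) ^ 2 =
      ∑' y, ∑' z, (allConn {x, y, z}).indicator (fun _ => (1 : ℝ≥0∞)) ω := by
  rw [eCard_eq_tsum, sq, ← ENNReal.tsum_mul_right]
  simp only [← ENNReal.tsum_mul_left]
  refine tsum_congr fun y => tsum_congr fun z => ?_
  rw [indicator_cluster ω x z, indicator_mul_allConn]

theorem eCard_cluster_cube (ω : Sym2 W → Bool) (x : W) :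
    eCard (cluster ω x) ^ 3 =
      ∑' y, ∑' z, ∑' w, (allConn {x, y, z, w}).indicator (fun _ => (1 : ℝ≥0∞)) ω := by
  rw [pow_succ', eCard_cluster_sq, eCard_eq_tsum, ← ENNReal.tsum_mul_right]
  simp only [← ENNReal.tsum_mul_left, indicator_mul_allConn]

theorem measurable_indicator_allConn [Countable W] {s : Set W} (hs : s.Finite) :
    Measurable ((allConn s).indicator fun _ => (1 : ℝ≥0∞)) :=
  measurable_const.indicator (measurableSet_allConn hs)

theorem lintegral_indicator_allConn [Countable W] {s : Set W} (hs : s.Finite) :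
    ∫⁻ ω, (allConn s).indicator (fun _ => (1 : ℝ≥0∞)) ω ∂μ = μ (allConn s) := by
  rw [lintegral_indicator (measurableSet_allConn hs)]
  simp

theorem lintegral_eCard_cluster_sq [Countable W] (x : W) :
    ∫⁻ ω, eCard (cluster ω x) ^ 2 ∂μ = ∑' y, ∑' z, μ (allConn {x, y, z}) := by
  have hm : ∀ y z, Measurable ((allConn {x, y, z}).indicator fun _ => (1 : ℝ≥0∞)) := fun _ _ =>
    measurable_indicator_allConn (by simp)
  simp only [eCard_cluster_sq]
  rw [lintegral_tsum fun y => (Measurable.tsum fun z => hm y z).aemeasurable]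
  refine tsum_congr fun y => ?_
  rw [lintegral_tsum fun z => (hm y z).aemeasurable]
  exact tsum_congr fun z => lintegral_indicator_allConn (by simp)

theorem lintegral_eCard_cluster_cube [Countable W] (x : W) :
    ∫⁻ ω, eCard (cluster ω x) ^ 3 ∂μ = ∑' y, ∑' z, ∑' w, μ (allConn {x, y, z, w}) := by
  have hm : ∀ y z w, Measurable ((allConn {x, y, z, w}).indicator fun _ => (1 : ℝ≥0∞)) :=
    fun _ _ _ => measurable_indicator_allConn (by simp)
  simp only [eCard_cluster_cube]
  rw [lintegral_tsum fun y =>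
    (Measurable.tsum fun z => Measurable.tsum fun w => hm y z w).aemeasurable]
  refine tsum_congr fun y => ?_
  rw [lintegral_tsum fun z => (Measurable.tsum fun w => hm y z w).aemeasurable]
  refine tsum_congr fun z => ?_
  rw [lintegral_tsum fun w => (hm y z w).aemeasurable]
  exact tsum_congr fun w => lintegral_indicator_allConn (by simp)

/-- Summation over three vertices of the six-term bound on the four-point function. -/
theorem tsum_pairing_eq {T : W → W → W → ℝ≥0∞} {R : W → W → ℝ≥0∞} {M S : ℝ≥0∞}
    (hT₁ : ∀ x y z, T x y z = T y x z) (hT₂ : ∀ x y z, T x y z = T x z y)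
    (hR : ∀ x y, R x y = R y x) (hM : ∀ x, ∑' y, ∑' z, T x y z = M)
    (hS : ∀ x, ∑' y, R x y = S) (a : W) :
    ∑' b, ∑' c, ∑' d, ((T a b c + T a c d) * R b d + (T a b c + T a b d) * R c d +
      (T a b d + T a c d) * R b c + (T a b c + T b c d) * R a d + (T a b d + T b c d) * R a c +
      (T a c d + T b c d) * R a b) = 12 * (M * S) := by
  have hswap : ∀ f : W → W → W → ℝ≥0∞, ∑' b, ∑' c, ∑' d, f b c d = ∑' b, ∑' d, ∑' c, f b c d :=
    fun f => tsum_congr fun b => ENNReal.tsum_comm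
  have hrot : ∀ f : W → W → W → ℝ≥0∞, ∑' b, ∑' c, ∑' d, f b c d = ∑' c, ∑' d, ∑' b, f b c d :=
    fun f => by rw [ENNReal.tsum_comm]; exact tsum_congr fun c => ENNReal.tsum_comm
  have hone : ∀ g : W → W → W, ∑' x, ∑' y, ∑' z, T a x y * R (g x y) z = M * S := by
    intro g
    simp only [ENNReal.tsum_mul_left, hS, ENNReal.tsum_mul_right, hM]
  have htwo : ∑' x, ∑' y, ∑' z, T x y z * R a x = M * S := by
    simp only [ENNReal.tsum_mul_right, hM, ENNReal.tsum_mul_left, hS]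
  have e1 : ∑' b, ∑' c, ∑' d, T a b c * R b d = M * S := hone fun b _ => b
  have e2 : ∑' b, ∑' c, ∑' d, T a c d * R b d = M * S := by
    rw [hrot]
    simpa only [hR] using hone fun _ d => d
  have e3 : ∑' b, ∑' c, ∑' d, T a b c * R c d = M * S := hone fun _ c => c
  have e4 : ∑' b, ∑' c, ∑' d, T a b d * R c d = M * S := by
    rw [hswap]
    simpa only [hR] using hone fun _ d => d
  have e5 : ∑' b, ∑' c, ∑' d, T a b d * R b c = M * S := by
    rw [hswap]
    exact hone fun b _ => b
  have e6 : ∑' b, ∑' c, ∑' d, T a c d * R b c = M * S := by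
    rw [hrot]
    simpa only [hR] using hone fun c _ => c
  have e7 : ∑' b, ∑' c, ∑' d, T a b c * R a d = M * S := hone fun _ _ => a
  have e8 : ∑' b, ∑' c, ∑' d, T b c d * R a d = M * S := by
    rw [hrot, hrot, ← htwo]
    exact tsum_congr fun d => tsum_congr fun b => tsum_congr fun c => by rw [hT₂, hT₁]
  have e9 : ∑' b, ∑' c, ∑' d, T a b d * R a c = M * S := by
    rw [hswap]
    exact hone fun _ _ => a
  have e10 : ∑' b, ∑' c, ∑' d, T b c d * R a c = M * S := by
    rw [ENNReal.tsum_comm, ← htwo]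
    exact tsum_congr fun d => tsum_congr fun b => tsum_congr fun c => by rw [hT₁]
  have e11 : ∑' b, ∑' c, ∑' d, T a c d * R a b = M * S := by
    rw [hrot]
    exact hone fun _ _ => a
  simp only [add_mul, ENNReal.tsum_add, e1, e2, e3, e4, e5, e6, e7, e8, e9, e10, e11, htwo]
  ring

end Moments

end LRP

namespace LRP

/-- The third moment of the cluster volume under a transitive group of symmetries. -/
theorem IsPerc.lintegral_eCard_cluster_cube_le {W : Type*} [Countable W] {p : Sym2 W → ℝ}
    {μ : Measure (Sym2 W → Bool)} (hμ : IsPerc μ p) (h0 : ∀ e, 0 ≤ p e) (h1 : ∀ e, p e ≤ 1)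
    (htrans : ∀ x y : W, ∃ g : W ≃ W, (∀ e, p (e.map g) = p e) ∧ g x = y) (o : W) :
    ∫⁻ ω, eCard (cluster ω o) ^ 3 ∂μ ≤
      48 * (∫⁻ ω, eCard (cluster ω o) ^ 2 ∂μ) * ∑' x, μ {ω | Conn ω o x} ^ ((1 : ℝ) / 2) := by
  have hconn : ∀ x, {ω | Conn ω o x} = allConn {o, x} := by
    intro x
    ext ω
    simp [mem_allConn_insert]
  have hS : ∀ x, ∑' y, μ (allConn {x, y}) ^ ((1 : ℝ) / 2) =
      ∑' y, μ (allConn {o, y}) ^ ((1 : ℝ) / 2) := by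
    intro x
    obtain ⟨g, hg, rfl⟩ := htrans o x
    rw [← g.tsum_eq]
    refine tsum_congr fun y => ?_
    rw [← hμ.measure_allConn_image h0 h1 g hg (s := {o, y}) (by simp), Set.image_pair]
  have hM : ∀ x, ∑' y, ∑' z, μ (allConn {x, y, z}) = ∑' y, ∑' z, μ (allConn {o, y, z}) := by
    intro x
    obtain ⟨g, hg, rfl⟩ := htrans o x
    rw [← g.tsum_eq]
    refine tsum_congr fun y => ?_
    rw [← g.tsum_eq]
    refine tsum_congr fun z => ?_
    rw [← hμ.measure_allConn_image h0 h1 g hg (s := {o, y, z}) (by simp), Set.image_insert_eq,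
      Set.image_pair]
  have hsum := tsum_pairing_eq (T := fun x y z => μ (allConn {x, y, z}))
    (R := fun x y => μ (allConn {x, y}) ^ ((1 : ℝ) / 2))
    (fun x y z => by rw [Set.insert_comm]) (fun x y z => by rw [Set.pair_comm])
    (fun x y => by rw [Set.pair_comm]) hM hS o
  rw [lintegral_eCard_cluster_cube, lintegral_eCard_cluster_sq]
  simp only [hconn]
  refine (ENNReal.tsum_le_tsum fun b => ENNReal.tsum_le_tsum fun c => ENNReal.tsum_le_tsum fun d =>
    hμ.measure_allConn_four_le h0 h1 o b c d).trans (le_of_eq ?_)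
  simp only [ENNReal.tsum_mul_left]
  rw [hsum, ← mul_assoc, ← mul_assoc]
  norm_num

/-- There is a universal constant `C` (independent of the graph and
of `β`) such that for every unimodular transitive weighted graph `(V, J)` with a
distinguished vertex `o` and every `β ≥ 0`, Bernoulli bond percolation at parameter `β`
satisfies `E_β|K|³ ≤ C · E_β|K|² · Σ_{x ∈ V} √τ_β(o, x)`, where `K` is the cluster
of `o`. -/
theorem statement19 :
    ∃ C : ℝ, 0 < C ∧
      ∀ (Vt : Type) (_ : Countable Vt) (J : Vt → Vt → ℝ)
        (hsym : ∀ x y, J x y = J y x),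
        (∀ x y, 0 ≤ J x y) → (∀ x, J x x = 0) →
        (∀ x y : Vt, ∃ γ : Vt ≃ Vt, (∀ a b, J (γ a) (γ b) = J a b) ∧ γ x = y) →
        (∀ (o : Vt) (F : Vt → Vt → ℝ≥0∞),
          (∀ γ : Vt ≃ Vt, (∀ a b, J (γ a) (γ b) = J a b) →
            ∀ a b, F (γ a) (γ b) = F a b) →
          (∑' x, F o x) = ∑' x, F x o) →
        ∀ (o : Vt) (β : ℝ), 0 ≤ β →
          ∀ μ : Measure (Sym2 Vt → Bool),
            IsPerc μ (Sym2.lift ⟨fun x y => edgeProb (β * J x y), fun x y => by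
              show edgeProb (β * J x y) = edgeProb (β * J y x); rw [hsym x y]⟩) →
            (∫⁻ ω, (eCard (cluster ω o)) ^ 3 ∂μ) ≤
              ENNReal.ofReal C * (∫⁻ ω, (eCard (cluster ω o)) ^ 2 ∂μ) *
                ∑' x : Vt, (μ {ω | Conn ω o x}) ^ ((1 : ℝ) / 2) := by
  refine ⟨48, by norm_num, ?_⟩
  intro V _ J hsym hJ _ htrans _ o β hβ μ hμ
  rw [show ENNReal.ofReal 48 = 48 by norm_num]
  refine hμ.lintegral_eCard_cluster_cube_le (fun e => ?_) (fun e => ?_) (fun x y => ?_) o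
  · induction e with | _ x y
    simpa [edgeProb] using mul_nonneg hβ (hJ x y)
  · induction e with | _ x y
    simpa [edgeProb] using (Real.exp_pos _).le
  · obtain ⟨g, hg, hgx⟩ := htrans x y
    refine ⟨g, fun e => ?_, hgx⟩
    induction e with | _ x y
    simp [hg]

end LRP
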